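/- Let f be a dimension function with f ⪯ d (i.e. f(y)/y^d ≤ f(x)/x^d for 0 < x < y). Let {B_k} be a sequence of balls in [0,1]^d with radii tending to 0 such that L^d(limsup_k B_k) = 1, and let {E_k} be open sets with E_k ⊂ B_k. If there is a constant c > 0 with H^f_∞(E_k) > c·L^d(B_k) for all k, then H^f(limsup_k E_k) = H^f([0,1]^d). -/

import Mathlib

open MeasureTheory

/-- Hausdorff `f`-content: infimum of `∑ f(diam B_i)` over countable covers by balls. -/
noncomputable def hausdorffContent {X : Type*} [PseudoMetricSpace X] (f : ℝ → ℝ) (E : Set X) :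
    ENNReal :=
  ⨅ (c : ℕ → X) (r : ℕ → ℝ) (_ : ∀ i, 0 < r i) (_ : E ⊆ ⋃ i, Metric.ball (c i) (r i)),
    ∑' i, ENNReal.ofReal (f (2 * r i))

/-- Hausdorff `f`-measure as a metric outer measure. -/
noncomputable def hausdorffFMeasure (d : ℕ) (f : ℝ → ℝ) : Measure (Fin d → ℝ) :=
  Measure.mkMetric (fun r : ENNReal => ENNReal.ofReal (f r.toReal))

section MassTransference

open Set Metric Filter Topology ENNReal

/-- Dimension functions `f` with `f ⪯ d`. -/
structure IsDimensionFunction (d : ℕ) (f : ℝ → ℝ) : Prop where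
  continuousOn : ContinuousOn f (Ici 0)
  monotoneOn : MonotoneOn f (Ici 0)
  map_zero : f 0 = 0
  map_pos : ∀ x, 0 < x → 0 < f x
  prec : ∀ x y : ℝ, 0 < x → x < y → f y / y ^ d ≤ f x / x ^ d

namespace IsDimensionFunction

variable {d : ℕ} {f : ℝ → ℝ}

lemma div_pow_anti (hf : IsDimensionFunction d f) {s t : ℝ} (hs : 0 < s) (hst : s ≤ t) :
    f t / t ^ d ≤ f s / s ^ d := by
  rcases hst.eq_or_lt with rfl | h
  · exact le_rfl
  · exact hf.prec s t hs h

lemma map_mul_le (hf : IsDimensionFunction d f) {a s : ℝ} (ha : 1 ≤ a) (hs : 0 < s) :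
    f (a * s) ≤ a ^ d * f s := by
  have ha0 : 0 < a := by linarith
  have h := hf.div_pow_anti hs (le_mul_of_one_le_left hs.le ha)
  rw [div_le_div_iff₀ (by positivity) (by positivity), mul_pow] at h
  have hsd : 0 < s ^ d := by positivity
  refine le_of_mul_le_mul_right (h.trans_eq ?_) hsd
  ring

lemma ofReal_map_mul_le (hf : IsDimensionFunction d f) {a s : ℝ} (ha : 1 ≤ a) (hs : 0 < s) :
    ENNReal.ofReal (f (a * s)) ≤ ENNReal.ofReal (a ^ d) * ENNReal.ofReal (f s) := by
  rw [← ENNReal.ofReal_mul (by positivity)]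
  exact ENNReal.ofReal_le_ofReal (hf.map_mul_le ha hs)

lemma exists_map_le (hf : IsDimensionFunction d f) {b : ℝ} (hb : 0 < b) {η : ENNReal}
    (hη : 0 < η) : ∃ s, 0 < s ∧ s ≤ b ∧ ENNReal.ofReal (f (2 * s)) ≤ η := by
  have h1 : Tendsto f (𝓝[≥] 0) (𝓝 0) := by
    have := hf.continuousOn 0 self_mem_Ici
    rwa [ContinuousWithinAt, hf.map_zero] at this
  have h2 : Tendsto (fun s : ℝ => 2 * s) (𝓝[>] 0) (𝓝[≥] 0) := by
    refine tendsto_nhdsWithin_of_tendsto_nhds_of_eventually_within _ ?_ ?_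
    · have : Tendsto (fun s : ℝ => 2 * s) (𝓝 0) (𝓝 (2 * 0)) := tendsto_id.const_mul 2
      simpa using this.mono_left nhdsWithin_le_nhds
    · filter_upwards [self_mem_nhdsWithin] with s hs
      exact mul_nonneg zero_le_two (le_of_lt (mem_Ioi.1 hs))
  have h3 : Tendsto (fun s : ℝ => ENNReal.ofReal (f (2 * s))) (𝓝[>] 0) (𝓝 0) := by
    simpa using ENNReal.tendsto_ofReal (h1.comp h2)
  obtain ⟨s, h, hs⟩ := ((h3.eventually (gt_mem_nhds hη)).and
    (Ioc_mem_nhdsGT hb)).exists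
  exact ⟨s, hs.1, hs.2, h.le⟩

lemma exists_seq_map_le (hf : IsDimensionFunction d f) {b : ℝ} (hb : 0 < b) {η : ENNReal}
    (hη : η ≠ 0) (ι : Type*) [Countable ι] :
    ∃ s : ι → ℝ, (∀ i, 0 < s i) ∧ (∀ i, s i ≤ b) ∧
      ∑' i, ENNReal.ofReal (f (2 * s i)) ≤ η := by
  obtain ⟨ε, hε, hsum⟩ := ENNReal.exists_pos_sum_of_countable' hη ι
  choose s h1 h2 h3 using fun i => hf.exists_map_le hb (hε i)
  exact ⟨s, h1, h2, (ENNReal.tsum_le_tsum h3).trans hsum.le⟩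

/-- Any countable cover by balls bounds the Hausdorff content. -/
lemma hausdorffContent_le_tsum (hf : IsDimensionFunction d f) {X : Type*} [PseudoMetricSpace X]
    [Nonempty X] {O : Set X} {ι : Type*} [Countable ι] (y : ι → X) (s : ι → ℝ) (hs : ∀ i, 0 < s i)
    (hO : O ⊆ ⋃ i, ball (y i) (s i)) :
    hausdorffContent f O ≤ ∑' i, ENNReal.ofReal (f (2 * s i)) := by
  obtain ⟨x⟩ := ‹Nonempty X›
  refine ENNReal.le_of_forall_pos_le_add fun η hη _ => ?_
  obtain ⟨e, he0, -, he⟩ := hf.exists_seq_map_le one_pos (ENNReal.coe_ne_zero.2 hη.ne') ℕ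
  obtain ⟨hden⟩ := nonempty_denumerable (ι ⊕ ℕ)
  let φ : ℕ ≃ ι ⊕ ℕ := (Denumerable.eqv _).symm
  let c : ι ⊕ ℕ → X := Sum.elim y fun _ => x
  let ρ : ι ⊕ ℕ → ℝ := Sum.elim s e
  have hρ : ∀ j, 0 < ρ j := by rintro (i | n); exacts [hs i, he0 n]
  have hcov : O ⊆ ⋃ n, ball (c (φ n)) (ρ (φ n)) := fun z hz => by
    obtain ⟨i, hi⟩ := mem_iUnion.1 (hO hz)
    exact mem_iUnion.2 ⟨φ.symm (Sum.inl i), by simpa [c, ρ] using hi⟩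
  calc hausdorffContent f O ≤ ∑' n, ENNReal.ofReal (f (2 * ρ (φ n))) :=
        iInf₂_le_of_le (fun n => c (φ n)) (fun n => ρ (φ n)) <|
          iInf₂_le (fun n => hρ (φ n)) hcov
    _ = ∑' j, ENNReal.ofReal (f (2 * ρ j)) :=
        φ.tsum_eq fun j => ENNReal.ofReal (f (2 * ρ j))
    _ = ∑' i, ENNReal.ofReal (f (2 * s i)) + ∑' n, ENNReal.ofReal (f (2 * e n)) :=
        Summable.tsum_sum ENNReal.summable ENNReal.summable
    _ ≤ _ := by gcongr

end IsDimensionFunction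

lemma tsum_tsum_le_of_pairwiseDisjoint {ι κ : Type*} (g : ι → ENNReal) {S : κ → Set ι}
    (hS : Pairwise (Function.onFun Disjoint S)) :
    ∑' b, ∑' i : S b, g i ≤ ∑' i, g i := by
  rw [← ENNReal.tsum_sigma (fun b (i : S b) => g i)]
  refine ENNReal.tsum_comp_le_tsum_of_injective
    (f := fun p : Σ b, S b => (p.2 : ι)) ?_ g
  rintro ⟨b, i, hi⟩ ⟨b', j, hj⟩ (rfl : i = j)
  obtain rfl : b = b' := by
    by_contra h
    exact Set.disjoint_left.1 (hS h) hi hj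
  rfl

variable {d : ℕ} {f : ℝ → ℝ}

lemma volume_ball_fin (a : Fin d → ℝ) {r : ℝ} (hr : 0 < r) :
    volume (ball a r) = ENNReal.ofReal ((2 * r) ^ d) := by
  simpa using Real.volume_pi_ball a hr

lemma volume_closedBall_fin (a : Fin d → ℝ) {r : ℝ} (hr : 0 < r) :
    volume (closedBall a r) = ENNReal.ofReal ((2 * r) ^ d) := by
  simpa using Real.volume_pi_closedBall a hr.le

/-- An open set covered almost everywhere by balls has Hausdorff content controlled by them. -/
lemma hausdorffContent_le_of_ae_cover (hf : IsDimensionFunction d f) {O : Set (Fin d → ℝ)}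
    (hO : IsOpen O) {ι : Type*} [Countable ι] (y : ι → Fin d → ℝ) (s : ι → ℝ)
    (hs : ∀ i, 0 < s i) (hcov : volume (O \ ⋃ i, ball (y i) (s i)) = 0) :
    hausdorffContent f O ≤
      ENNReal.ofReal (3 ^ d + 11 ^ d) * ∑' i, ENNReal.ofReal (f (2 * s i)) := by
  classical
  set g : ι → ENNReal := fun i => ENNReal.ofReal (f (2 * s i))
  set T : Set (Fin d → ℝ) := O \ ⋃ i, ball (y i) (3 * s i)
  have key : ∀ x ∈ T, ∃ ρ : ℝ, 0 < ρ ∧ ρ ≤ 1 ∧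
      ENNReal.ofReal (f (2 * ρ)) ≤
        ∑' i : {i | ball (y i) (s i) ⊆ closedBall x (2 * ρ)}, g i := by
    rintro x ⟨hxO, hx⟩
    obtain ⟨ε, hε, hball⟩ := Metric.isOpen_iff.1 hO x hxO
    set ρ := min ε 1
    have hρ : 0 < ρ := lt_min hε one_pos
    refine ⟨ρ, hρ, min_le_right _ _, ?_⟩
    set S := {i | ball (y i) (s i) ⊆ closedBall x (2 * ρ)}
    have hmeet : ∀ i, (ball (y i) (s i) ∩ ball x ρ).Nonempty → i ∈ S ∧ s i ≤ ρ := by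
      rintro i ⟨p, hp1, hp2⟩
      have h1 : 3 * s i ≤ dist x (y i) := by
        by_contra! h
        exact hx (mem_iUnion.2 ⟨i, h⟩)
      have h2 : dist x (y i) ≤ dist p x + dist p (y i) := dist_triangle_left _ _ _
      rw [mem_ball] at hp1 hp2
      have := hs i
      refine ⟨fun q hq => ?_, by linarith⟩
      rw [mem_ball] at hq
      have h3 : dist q x ≤ dist q (y i) + dist x (y i) := dist_triangle_right _ _ _
      rw [mem_closedBall]
      linarith
    set S' := {i | i ∈ S ∧ s i ≤ ρ}
    have hvol : volume (ball x ρ) ≤ ∑' i : S', volume (ball (y i) (s i)) := by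
      calc volume (ball x ρ) ≤ volume ((⋃ i : S', ball (y i) (s i)) ∪
              (O \ ⋃ i, ball (y i) (s i))) := by
            refine measure_mono fun p hp => ?_
            by_cases h : p ∈ ⋃ i, ball (y i) (s i)
            · obtain ⟨i, hi⟩ := mem_iUnion.1 h
              exact Or.inl (mem_iUnion.2 ⟨⟨i, hmeet i ⟨p, hi, hp⟩⟩, hi⟩)
            · exact Or.inr ⟨hball (ball_subset_ball (min_le_left _ _) hp), h⟩
        _ ≤ volume (⋃ i : S', ball (y i) (s i)) + 0 := by
            rw [← hcov]; exact measure_union_le _ _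
        _ ≤ _ := by rw [add_zero]; exact measure_iUnion_le _
    have hfρ := hf.map_pos (2 * ρ) (by positivity)
    set a := f (2 * ρ) / (2 * ρ) ^ d with ha
    have ha0 : 0 < a := by positivity
    calc ENNReal.ofReal (f (2 * ρ)) = ENNReal.ofReal a * volume (ball x ρ) := by
          rw [volume_ball_fin x hρ, ← ENNReal.ofReal_mul ha0.le, ha,
            div_mul_cancel₀ _ (by positivity)]
      _ ≤ ENNReal.ofReal a * ∑' i : S', volume (ball (y i) (s i)) := by gcongr
      _ = ∑' i : S', ENNReal.ofReal a * volume (ball (y i) (s i)) := ENNReal.tsum_mul_left.symm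
      _ ≤ ∑' i : S', g i := by
          refine ENNReal.tsum_le_tsum fun i => ?_
          have hsi := hs i
          rw [volume_ball_fin _ (hs i), ← ENNReal.ofReal_mul ha0.le]
          refine ENNReal.ofReal_le_ofReal ?_
          rw [← le_div_iff₀ (by positivity)]
          exact hf.div_pow_anti (by positivity) (by linarith [i.2.2])
      _ ≤ ∑' i : S, g i := ENNReal.tsum_mono_subtype g fun i hi => hi.1
  choose! ρ hρ0 hρ1 hρ using key
  obtain ⟨u, huT, hdisj, hucov⟩ := Vitali.exists_disjoint_subfamily_covering_enlargement_closedBall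
    T (fun x => x) (fun x => 2 * ρ x) 2 (fun x hx => by linarith [hρ1 x hx]) 5 (by norm_num)
  have hucount : u.Countable := hdisj.countable_of_nonempty_interior fun x hx => by
    have := hρ0 x (huT hx)
    exact ⟨x, ball_subset_interior_closedBall (mem_ball_self (by positivity))⟩
  have := hucount.to_subtype
  have hpd : Pairwise (Function.onFun Disjoint
      fun b : u => {i | ball (y i) (s i) ⊆ closedBall (b : Fin d → ℝ) (2 * ρ b)}) := by
    intro b b' hbb'
    refine Set.disjoint_left.2 fun i hi hi' => ?_
    have hy : y i ∈ ball (y i) (s i) := mem_ball_self (hs i)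
    exact Set.disjoint_left.1 (hdisj b.2 b'.2 (Subtype.coe_injective.ne hbb')) (hi hy) (hi' hy)
  have hcontent := hf.hausdorffContent_le_tsum (O := O) (ι := ι ⊕ u)
    (Sum.elim y fun b => b) (Sum.elim (fun i => 3 * s i) fun b => 11 * ρ b)
    (by
      rintro (i | b)
      · have := hs i; simpa using this
      · have := hρ0 b (huT b.2); simpa using this)
    (by
      intro p hp
      by_cases h : p ∈ ⋃ i, ball (y i) (3 * s i)
      · obtain ⟨i, hi⟩ := mem_iUnion.1 h
        exact mem_iUnion.2 ⟨Sum.inl i, hi⟩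
      · obtain ⟨b, hb, hsub⟩ := hucov p ⟨hp, h⟩
        have h0 := hρ0 b (huT hb)
        have h1 := hρ0 p ⟨hp, h⟩
        have h2 := hsub (mem_closedBall_self (by positivity))
        refine mem_iUnion.2 ⟨Sum.inr ⟨b, hb⟩, ?_⟩
        rw [mem_closedBall] at h2
        simp only [Sum.elim_inr, mem_ball]
        linarith)
  refine hcontent.trans ?_
  rw [Summable.tsum_sum ENNReal.summable ENNReal.summable,
    ENNReal.ofReal_add (by positivity) (by positivity), add_mul]
  simp only [Sum.elim_inl, Sum.elim_inr]
  gcongr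
  · rw [← ENNReal.tsum_mul_left]
    refine ENNReal.tsum_le_tsum fun i => ?_
    have := hs i
    rw [show 2 * (3 * s i) = 3 * (2 * s i) by ring]
    exact hf.ofReal_map_mul_le (by norm_num) (by positivity)
  · calc ∑' b : u, ENNReal.ofReal (f (2 * (11 * ρ b)))
        ≤ ∑' b : u, ENNReal.ofReal (11 ^ d) * ∑' i : {i | ball (y i) (s i) ⊆
            closedBall (b : Fin d → ℝ) (2 * ρ b)}, g i := by
          refine ENNReal.tsum_le_tsum fun b => ?_
          have := hρ0 b (huT b.2)
          rw [show 2 * (11 * ρ b) = 11 * (2 * ρ b) by ring]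
          exact (hf.ofReal_map_mul_le (by norm_num) (by positivity)).trans
            (by gcongr; exact hρ b (huT b.2))
      _ ≤ ENNReal.ofReal (11 ^ d) * ∑' i, g i := by
          rw [ENNReal.tsum_mul_left]
          gcongr
          exact tsum_tsum_le_of_pairwiseDisjoint g hpd


lemma exists_ball_subset_inter {p q x y : Fin d → ℝ} {r s : ℝ} (hr : 0 < r) (hrs : r ≤ s)
    (hqy : q ∈ ball y s) (hqx : q ∈ closedBall x r) (hpx : p ∈ closedBall x r) :
    ∃ z, ball z (r / 2) ⊆ ball y s ∧ ball z (r / 2) ⊆ closedBall p (3 * r) := by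
  have hs : 0 < s := by linarith
  set t := r / 2 / s with ht
  have ht0 : 0 < t := by positivity
  have hts : t * s = r / 2 := by rw [ht]; field_simp
  have ht1 : t < 1 := by nlinarith
  rw [mem_ball] at hqy
  rw [mem_closedBall] at hqx hpx
  have h1 : dist (AffineMap.lineMap q y t) q = t * dist q y := by
    rw [dist_lineMap_left, Real.norm_of_nonneg ht0.le]
  have h2 : dist (AffineMap.lineMap q y t) y = (1 - t) * dist q y := by
    rw [dist_lineMap_right, Real.norm_of_nonneg (by linarith)]
  have h3 : t * dist q y ≤ r / 2 := by nlinarith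
  have h4 : (1 - t) * dist q y ≤ s - r / 2 := by nlinarith
  refine ⟨AffineMap.lineMap q y t, fun w hw => ?_, fun w hw => ?_⟩
  · rw [mem_ball] at hw ⊢
    have := dist_triangle w (AffineMap.lineMap q y t) y
    linarith
  · rw [mem_ball] at hw
    rw [mem_closedBall]
    have e1 := dist_triangle w (AffineMap.lineMap q y t) q
    have e2 := dist_triangle w q x
    have e3 := dist_triangle_right w p x
    linarith

/-- If balls `ball (y i) (s i)` with finite total gauge cover almost all of each `E k` near `W`,
then a set `W` disjoint from those balls has volume zero. -/
lemma volume_eq_zero_of_ae_cover (hf : IsDimensionFunction d f)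
    {x : ℕ → Fin d → ℝ} {r : ℕ → ℝ} (hr_pos : ∀ k, 0 < r k)
    (hr_lim : Tendsto r atTop (𝓝 0)) {E : ℕ → Set (Fin d → ℝ)} (hE_open : ∀ k, IsOpen (E k))
    (hE_sub : ∀ k, E k ⊆ closedBall (x k) (r k)) {c : ℝ} (hc : 0 < c)
    (hcont : ∀ k, ENNReal.ofReal c * volume (closedBall (x k) (r k)) < hausdorffContent f (E k))
    {ι : Type*} [Countable ι] {y : ι → Fin d → ℝ} {s : ι → ℝ} (hs : ∀ i, 0 < s i)
    (hsum : ∑' i, ENNReal.ofReal (f (2 * s i)) ≠ ∞) {U W : Set (Fin d → ℝ)} (hU : IsOpen U)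
    (hWU : W ⊆ U) (hWV : Disjoint W (⋃ i, ball (y i) (s i)))
    (hWlim : ∀ᵐ p, p ∈ W → p ∈ limsup (fun k => closedBall (x k) (r k)) atTop) (N : ℕ)
    (hnull : ∀ k, N ≤ k → closedBall (x k) (r k) ⊆ U →
      volume (E k \ ⋃ i, ball (y i) (s i)) = 0) :
    volume W = 0 := by
  classical
  set g : ι → ENNReal := fun i => ENNReal.ofReal (f (2 * s i))
  set S : ℕ → Set ι := fun k => {i | (ball (y i) (s i) ∩ closedBall (x k) (r k)).Nonempty}
  set C := ENNReal.ofReal (3 ^ d + 11 ^ d)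
  have hk : ∀ k, volume (E k \ ⋃ i, ball (y i) (s i)) = 0 →
      ENNReal.ofReal c * volume (closedBall (x k) (r k)) ≤ C * ∑' i : S k, g i := by
    intro k h0
    refine (hcont k).le.trans (hausdorffContent_le_of_ae_cover hf (hE_open k)
      (fun i : S k => y i) (fun i => s i) (fun i => hs i) (measure_mono_null ?_ h0))
    rintro p ⟨hpE, hp⟩
    refine ⟨hpE, fun hp' => hp ?_⟩
    obtain ⟨i, hi⟩ := mem_iUnion.1 hp'
    exact mem_iUnion.2 ⟨⟨i, ⟨p, hi, hE_sub k hpE⟩⟩, hi⟩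
  set W' := {p | p ∈ W ∧ p ∈ limsup (fun k => closedBall (x k) (r k)) atTop ∧
    Tendsto (fun ρ => volume (W ∩ closedBall p ρ) / volume (closedBall p ρ)) (𝓝[>] 0) (𝓝 1)}
  have hWW' : volume W ≤ volume W' := by
    refine measure_mono_ae ?_
    filter_upwards [hWlim, ae_imp_of_ae_restrict
      (Besicovitch.ae_tendsto_measure_inter_div volume W)] with p h1 h2 h3
    exact ⟨h3, h1 h3, h2 h3⟩
  set ε : ℝ := (1 / 6) ^ d with hε
  have hε0 : 0 < ε := by positivity
  have hε1 : ε ≤ 1 := pow_le_one₀ (by norm_num) (by norm_num)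
  have hθ1 : ENNReal.ofReal (1 - ε) < 1 := by
    rw [ENNReal.ofReal_lt_one]; linarith
  have hF : ∀ F : Finset ι, ENNReal.ofReal c * volume W' ≤
      ENNReal.ofReal (15 ^ d) * C * ∑' i : {i // i ∉ F}, g i := by
    intro F
    set T := {k | N ≤ k ∧ closedBall (x k) (r k) ⊆ U ∧ r k ≤ 1 ∧ ∀ i ∈ S k, s i < r k ∧ i ∉ F}
    have hT : ∀ p ∈ W', ∃ k ∈ T, p ∈ closedBall (x k) (r k) := by
      rintro p ⟨hpW, hplim, hpd⟩
      obtain ⟨ρ, hρ, hρd⟩ := mem_nhdsGT_iff_exists_Ioo_subset.1 (hpd.eventually (lt_mem_nhds hθ1))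
      obtain ⟨δ, hδ, hδU⟩ := Metric.isOpen_iff.1 hU p (hWU hpW)
      have hfreq := mem_limsup_iff_frequently_mem.1 hplim
      have hev : ∀ {b : ℝ}, 0 < b → ∀ᶠ k in atTop, r k < b := fun hb =>
        hr_lim.eventually (gt_mem_nhds hb)
      have hevF : ∀ᶠ k in atTop, ∀ i ∈ F, r k < s i :=
        (Filter.eventually_all_finset F).2 fun i _ => hev (hs i)
      have hρ3 : 0 < ρ / 3 := div_pos hρ (by norm_num)
      obtain ⟨k, hpk, hkN, hkρ, hkδ, hk1, hkF⟩ := (hfreq.and_eventually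
        ((eventually_ge_atTop N).and ((hev hρ3).and ((hev (half_pos hδ)).and
          ((hev one_pos).and hevF))))).exists
      have hsmall : ∀ i ∈ S k, s i < r k := by
        rintro i ⟨q, hq1, hq2⟩
        by_contra! hle
        obtain ⟨z, hz1, hz2⟩ := exists_ball_subset_inter (hr_pos k) hle hq1 hq2 hpk
        have hrk := hr_pos k
        have h3 : 3 * r k ∈ Ioo 0 ρ := ⟨by positivity, by linarith⟩
        have hlt := hρd h3
        have hvolB := volume_closedBall_fin p (r := 3 * r k) (by positivity)
        have hvolpos : volume (closedBall p (3 * r k)) ≠ 0 := by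
          rw [hvolB]; simp only [ne_eq, ENNReal.ofReal_eq_zero, not_le]; positivity
        have hvoltop : volume (closedBall p (3 * r k)) ≠ ∞ := by
          rw [hvolB]; exact ENNReal.ofReal_ne_top
        rw [mem_ofPred_eq, ENNReal.lt_div_iff_mul_lt (Or.inl hvolpos) (Or.inl hvoltop)] at hlt
        have hz : volume (ball z (r k / 2)) =
            ENNReal.ofReal ε * volume (closedBall p (3 * r k)) := by
          rw [hvolB, volume_ball_fin z (by positivity), ← ENNReal.ofReal_mul hε0.le, hε, ← mul_pow]
          congr 2
          ring
        have hdis : Disjoint (W ∩ closedBall p (3 * r k)) (ball z (r k / 2)) := by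
          refine (hWV.mono_right ?_).mono_left inter_subset_left
          exact hz1.trans (subset_iUnion (fun i => ball (y i) (s i)) i)
        have hadd : volume (W ∩ closedBall p (3 * r k)) + volume (ball z (r k / 2)) ≤
            volume (closedBall p (3 * r k)) := by
          rw [← measure_union hdis measurableSet_ball]
          exact measure_mono (union_subset inter_subset_right hz2)
        refine absurd hadd (not_le.2 ?_)
        calc volume (closedBall p (3 * r k))
            = ENNReal.ofReal (1 - ε) * volume (closedBall p (3 * r k)) +
                volume (ball z (r k / 2)) := by
              rw [hz, ← add_mul, ← ENNReal.ofReal_add (by linarith) hε0.le]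
              simp
          _ < _ := ENNReal.add_lt_add_right
              (by rw [hz]; exact ENNReal.mul_ne_top ENNReal.ofReal_ne_top hvoltop) hlt
      refine ⟨k, ⟨hkN, fun q hq => hδU ?_, hk1.le, fun i hi => ⟨hsmall i hi, fun hiF => ?_⟩⟩, hpk⟩
      · rw [mem_closedBall] at hq hpk
        rw [mem_ball]
        linarith [dist_triangle_right q p (x k)]
      · exact lt_asymm (hsmall i hi) (hkF i hiF)
    obtain ⟨u, huT, hdisj, hucov⟩ :=
      Vitali.exists_disjoint_subfamily_covering_enlargement_closedBall
        T x (fun k => 3 * r k) 3 (fun k hk => by linarith [hk.2.2.1]) 5 (by norm_num)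
    have hpd : Pairwise (Function.onFun Disjoint
        fun b : u => {i : {i // i ∉ F} | (i : ι) ∈ S b}) := by
      intro b b' hbb'
      refine Set.disjoint_left.2 fun i hi hi' => ?_
      have aux : ∀ b : u, (i : ι) ∈ S b → y i ∈ closedBall (x b) (3 * r b) := by
        rintro b hi
        have h1 := ((huT b.2).2.2.2 i hi).1
        obtain ⟨q, hq1, hq2⟩ := hi
        rw [mem_ball] at hq1
        rw [mem_closedBall] at hq2 ⊢
        have := hr_pos b
        linarith [dist_triangle_left (y i) (x b) q]
      exact Set.disjoint_left.1 (hdisj b.2 b'.2 (Subtype.coe_injective.ne hbb'))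
        (aux b hi) (aux b' hi')
    calc ENNReal.ofReal c * volume W'
        ≤ ENNReal.ofReal c * ∑' b : u, volume (closedBall (x b) (5 * (3 * r b))) := by
          gcongr
          refine (measure_mono fun p hp => ?_).trans (measure_iUnion_le _)
          obtain ⟨k, hkT, hpk⟩ := hT p hp
          obtain ⟨b, hb, hsub⟩ := hucov k hkT
          have := hr_pos k
          exact mem_iUnion.2 ⟨⟨b, hb⟩, hsub (closedBall_subset_closedBall (by linarith) hpk)⟩
      _ = ENNReal.ofReal (15 ^ d) *
            ∑' b : u, ENNReal.ofReal c * volume (closedBall (x b) (r b)) := by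
          rw [← ENNReal.tsum_mul_left, ← ENNReal.tsum_mul_left]
          refine tsum_congr fun b => ?_
          have := hr_pos b
          rw [volume_closedBall_fin _ (by positivity), volume_closedBall_fin _ (by positivity),
            mul_left_comm (ENNReal.ofReal (15 ^ d)),
            ← ENNReal.ofReal_mul (p := 15 ^ d) (by positivity), ← mul_pow]
          congr 3
          ring
      _ ≤ ENNReal.ofReal (15 ^ d) *
            ∑' b : u, C * ∑' i : {i : {i // i ∉ F} | (i : ι) ∈ S b}, g (i : {i // i ∉ F}) := by
          refine mul_le_mul' le_rfl (ENNReal.tsum_le_tsum fun b => ?_)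
          have hbT := huT b.2
          refine (hk b (hnull b hbT.1 hbT.2.1)).trans ?_
          gcongr
          exact ENNReal.tsum_comp_le_tsum_of_injective
            (f := fun i : S b => (⟨⟨i, (hbT.2.2.2 i i.2).2⟩, i.2⟩ :
              {i : {i // i ∉ F} | (i : ι) ∈ S b}))
            (fun i j hij => by simpa [Subtype.ext_iff] using hij)
            (fun i => g (i : {i // i ∉ F}))
      _ ≤ _ := by
          rw [ENNReal.tsum_mul_left, ← mul_assoc]
          gcongr
          exact tsum_tsum_le_of_pairwiseDisjoint (fun i : {i // i ∉ F} => g i) hpd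
  have hlim := ENNReal.Tendsto.const_mul (a := ENNReal.ofReal (15 ^ d) * C)
    (ENNReal.tendsto_tsum_compl_atTop_zero hsum)
    (Or.inr (ENNReal.mul_ne_top ENNReal.ofReal_ne_top ENNReal.ofReal_ne_top))
  rw [mul_zero] at hlim
  have h0 := le_antisymm (ge_of_tendsto' hlim hF) zero_le
  rcases mul_eq_zero.1 h0 with h | h
  · exact absurd (ENNReal.ofReal_eq_zero.1 h) (not_le.2 hc)
  · exact le_antisymm (hWW'.trans h.le) zero_le

/-- Balls of finite total gauge that cover `limsup E` cover almost all of `I`. -/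
lemma ae_cover_of_limsup_subset (hf : IsDimensionFunction d f)
    {x : ℕ → Fin d → ℝ} {r : ℕ → ℝ} (hr_pos : ∀ k, 0 < r k)
    (hr_lim : Tendsto r atTop (𝓝 0))
    {I : Set (Fin d → ℝ)} (hB_sub : ∀ k, closedBall (x k) (r k) ⊆ I)
    (hB_full : volume (I \ limsup (fun k => closedBall (x k) (r k)) atTop) = 0)
    {E : ℕ → Set (Fin d → ℝ)} (hE_open : ∀ k, IsOpen (E k))
    (hE_sub : ∀ k, E k ⊆ closedBall (x k) (r k)) {c : ℝ} (hc : 0 < c)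
    (hcont : ∀ k, ENNReal.ofReal c * volume (closedBall (x k) (r k)) < hausdorffContent f (E k))
    {ι : Type*} [Countable ι] {y : ι → Fin d → ℝ} {s : ι → ℝ} (hs : ∀ i, 0 < s i)
    (hsum : ∑' i, ENNReal.ofReal (f (2 * s i)) ≠ ∞)
    (hcov : limsup E atTop ⊆ ⋃ i, ball (y i) (s i)) :
    volume (I \ ⋃ i, ball (y i) (s i)) = 0 := by
  set V := ⋃ i, ball (y i) (s i)
  have hV : IsOpen V := isOpen_iUnion fun i => isOpen_ball
  by_contra hne
  set ν := volume.restrict (I \ V) with hν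
  have hνapply : ∀ {A : Set (Fin d → ℝ)}, IsOpen A → ν A = volume (A ∩ (I \ V)) :=
    fun hA => Measure.restrict_apply hA.measurableSet
  set P := ν.support with hP
  have hPc : IsClosed P := Measure.isClosed_support
  have hdense : ∀ N, Dense ((↑) ⁻¹' (⋃ k ≥ N, E k) : Set P) := by
    intro N
    rw [dense_iff_inter_open]
    rintro O hO ⟨⟨p, hpP⟩, hpO⟩
    obtain ⟨U, hU, rfl⟩ := isOpen_induced_iff.1 hO
    by_contra hemp
    have hsub : ∀ k, N ≤ k → E k ⊆ U → E k ⊆ Pᶜ := fun k hk hEU q hq hqP =>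
      hemp ⟨⟨q, hqP⟩, hEU hq, mem_iUnion₂.2 ⟨k, hk, hq⟩⟩
    have hpos : 0 < ν U := by
      rw [hP, Measure.mem_support_iff_forall] at hpP
      exact hpP U (hU.mem_nhds hpO)
    rw [hνapply hU] at hpos
    refine hpos.ne' (volume_eq_zero_of_ae_cover hf hr_pos hr_lim hE_open hE_sub hc hcont hs hsum
      hU inter_subset_left (Set.disjoint_left.2 fun q hq => hq.2.2) ?_ N fun k hk hkU => ?_)
    · rw [ae_iff]
      refine measure_mono_null (fun q hq => ?_) hB_full
      simp only [mem_ofPred_eq, Classical.not_imp] at hq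
      exact ⟨hq.1.2.1, hq.2⟩
    · have h1 : ν (E k) = 0 :=
        measure_mono_null (hsub k hk ((hE_sub k).trans hkU)) Measure.measure_compl_support
      rw [hνapply (hE_open k)] at h1
      exact measure_mono_null (t := E k ∩ (I \ V))
        (fun q hq => ⟨hq.1, hB_sub k (hE_sub k hq.1), hq.2⟩) h1
  have hPne : P.Nonempty := by
    by_contra h
    have h1 : ν Pᶜ = 0 := Measure.measure_compl_support
    rw [not_nonempty_iff_eq_empty.1 h, compl_empty, hνapply isOpen_univ, univ_inter] at h1
    exact hne h1
  have := hPne.to_subtype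
  have := hPc.completeSpace_coe
  obtain ⟨⟨p, hpP⟩, hp⟩ := (dense_iInter_of_isOpen_nat
    (fun N => (isOpen_biUnion fun k _ => hE_open k).preimage continuous_subtype_val)
    hdense).nonempty
  have hpE : p ∈ limsup E atTop := by
    rw [mem_limsup_iff_frequently_mem, frequently_atTop]
    intro N
    obtain ⟨k, hk, hpk⟩ := mem_iUnion₂.1 (mem_iInter.1 hp N)
    exact ⟨k, hk, hpk⟩
  refine Measure.subset_compl_support_of_isOpen hV ?_ (hcov hpE) hpP
  rw [hνapply hV]
  exact measure_mono_null (fun q hq => hq.2.2 hq.1) measure_empty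

/-- Small sets are contained in open balls of comparable gauge. -/
lemma exists_subset_ball_map_le (hf : IsDimensionFunction d f) {b : ℝ} (hb : 0 < b)
    {A : Set (Fin d → ℝ)} (hA : ediam A ≤ ENNReal.ofReal (b / 4)) {η : ENNReal} (hη : 0 < η) :
    ∃ y s, 0 < s ∧ 2 * s ≤ b ∧ A ⊆ ball y s ∧ ENNReal.ofReal (f (2 * s)) ≤
      ENNReal.ofReal (4 ^ d) * (⨆ _ : A.Nonempty, ENNReal.ofReal (f (ediam A).toReal)) + η := by
  have hAtop : ediam A ≠ ∞ := ne_top_of_le_ne_top ENNReal.ofReal_ne_top hA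
  rcases eq_or_ne (ediam A) 0 with h0 | h0
  · obtain ⟨s, hs0, hsb, hs⟩ := hf.exists_map_le (half_pos hb) hη
    rcases A.eq_empty_or_nonempty with rfl | ⟨y, hy⟩
    · exact ⟨0, s, hs0, by linarith, empty_subset _, hs.trans le_add_self⟩
    · refine ⟨y, s, hs0, by linarith, fun z hz => ?_, hs.trans le_add_self⟩
      rw [mem_ball, ediam_eq_zero_iff.1 h0 hz hy, dist_self]
      exact hs0
  · have hne : A.Nonempty := by
      by_contra h
      rw [not_nonempty_iff_eq_empty] at h
      simp [h] at h0
    obtain ⟨y, hy⟩ := hne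
    have hD := ENNReal.toReal_pos h0 hAtop
    have hDb : (ediam A).toReal ≤ b / 4 := ENNReal.toReal_le_of_le_ofReal (by positivity) hA
    refine ⟨y, 2 * (ediam A).toReal, by positivity, by linarith, fun z hz => ?_, ?_⟩
    · rw [mem_ball]
      have : dist z y ≤ (ediam A).toReal := by
        rw [dist_edist]
        exact ENNReal.toReal_mono hAtop (edist_le_ediam_of_mem hz hy)
      linarith
    · rw [iSup_pos ⟨y, hy⟩, ← mul_assoc, show (2 * 2 : ℝ) = 4 by norm_num]
      exact (hf.ofReal_map_mul_le (by norm_num) hD).trans le_self_add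

lemma measure_le_tsum_of_diff_iUnion_eq_zero {α ι : Type*} [MeasurableSpace α] {μ : Measure α}
    [Countable ι] {I : Set α} {t : ι → Set α} (h : μ (I \ ⋃ i, t i) = 0) :
    μ I ≤ ∑' i, μ (t i) :=
  (measure_mono_ae (ae_le_set.2 h)).trans (measure_iUnion_le _)

/-- If covers of `A` by balls of finite total gauge always cover almost all of a set `I` of
volume one, and `f r / r ^ d` is unbounded, then `A` has infinite Hausdorff `f`-measure. -/
lemma hausdorffFMeasure_eq_top (hf : IsDimensionFunction d f) {I A : Set (Fin d → ℝ)}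
    (hI : volume I = 1)
    (hA : ∀ (y : ℕ → Fin d → ℝ) (s : ℕ → ℝ), (∀ i, 0 < s i) →
      ∑' i, ENNReal.ofReal (f (2 * s i)) ≠ ∞ → A ⊆ ⋃ i, ball (y i) (s i) →
      volume (I \ ⋃ i, ball (y i) (s i)) = 0)
    (hunb : ∀ L : ℝ, ∃ t, 0 < t ∧ L * t ^ d < f t) :
    hausdorffFMeasure d f A = ∞ := by
  set H := hausdorffFMeasure d f A with hH
  have hL : ∀ n : ℕ, (n : ENNReal) ≤ ENNReal.ofReal (4 ^ d) * H + 1 := by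
    intro n
    obtain ⟨b, hb, hbn⟩ := hunb n
    suffices h : ∀ t : ℕ → Set (Fin d → ℝ), A ⊆ iUnion t →
        (∀ i, ediam (t i) ≤ ENNReal.ofReal (b / 4)) →
        (n : ENNReal) ≤ ENNReal.ofReal (4 ^ d) *
          (∑' i, ⨆ _ : (t i).Nonempty, ENNReal.ofReal (f (ediam (t i)).toReal)) + 1 by
      have h4 : ENNReal.ofReal (4 ^ d) ≠ 0 := by
        simp only [ne_eq, ENNReal.ofReal_eq_zero, not_le]; positivity
      rw [← tsub_le_iff_right, ← ENNReal.div_le_iff' h4 ENNReal.ofReal_ne_top, hH,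
        hausdorffFMeasure, Measure.mkMetric_apply]
      refine le_iSup₂_of_le (ENNReal.ofReal (b / 4)) (by simpa using hb) ?_
      refine le_iInf fun t => le_iInf₂ fun h1 h2 => ?_
      rw [ENNReal.div_le_iff' h4 ENNReal.ofReal_ne_top, tsub_le_iff_right]
      exact h t h1 h2
    intro t hAt hdiam
    obtain ⟨η, hη0, hη⟩ := ENNReal.exists_pos_sum_of_countable' one_ne_zero ℕ
    choose y s hs0 hsb hts hfs using fun i => exists_subset_ball_map_le hf hb (hdiam i) (hη0 i)
    have hle : ∑' i, ENNReal.ofReal (f (2 * s i)) ≤ ENNReal.ofReal (4 ^ d) *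
        (∑' i, ⨆ _ : (t i).Nonempty, ENNReal.ofReal (f (ediam (t i)).toReal)) + 1 := by
      refine (ENNReal.tsum_le_tsum hfs).trans ?_
      rw [ENNReal.tsum_add, ENNReal.tsum_mul_left]
      gcongr
    refine le_trans ?_ hle
    by_cases hfin : ∑' i, ENNReal.ofReal (f (2 * s i)) = ∞
    · rw [hfin]; exact le_top
    have hnull := hA y s hs0 hfin (hAt.trans (iUnion_mono hts))
    have h1 : 1 ≤ ∑' i, volume (ball (y i) (s i)) :=
      hI ▸ measure_le_tsum_of_diff_iUnion_eq_zero hnull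
    calc (n : ENNReal) ≤ n * ∑' i, volume (ball (y i) (s i)) := le_mul_of_one_le_right' h1
      _ = ∑' i, n * volume (ball (y i) (s i)) := ENNReal.tsum_mul_left.symm
      _ ≤ _ := by
        refine ENNReal.tsum_le_tsum fun i => ?_
        have hsi := hs0 i
        rw [volume_ball_fin _ hsi, ← ENNReal.ofReal_natCast, ← ENNReal.ofReal_mul (by positivity)]
        refine ENNReal.ofReal_le_ofReal ?_
        rw [← le_div_iff₀ (by positivity)]
        refine le_trans ?_ (hf.div_pow_anti (by positivity) (hsb i))
        rw [le_div_iff₀ (by positivity)]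
        exact hbn.le
  by_contra hne
  obtain ⟨n, hn⟩ := ENNReal.exists_nat_gt (r := ENNReal.ofReal (4 ^ d) * H + 1)
    (ENNReal.add_ne_top.2 ⟨ENNReal.mul_ne_top ENNReal.ofReal_ne_top hne, one_ne_top⟩)
  exact absurd (hL n) (not_le.2 hn)

/-- If covers of `A` by balls of finite total gauge always cover almost all of a set `I` of
volume one, and `f r / r ^ d` is bounded, then `A` has outer volume at least one. -/
lemma one_le_volume_of_le_mul_pow {I A : Set (Fin d → ℝ)} (hI : volume I = 1)
    (hA : ∀ (ι : Type) [Countable ι] (y : ι → Fin d → ℝ) (s : ι → ℝ), (∀ i, 0 < s i) →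
      ∑' i, ENNReal.ofReal (f (2 * s i)) ≠ ∞ → A ⊆ ⋃ i, ball (y i) (s i) →
      volume (I \ ⋃ i, ball (y i) (s i)) = 0)
    {L : ℝ} (hL : ∀ t, 0 < t → f t ≤ L * t ^ d) :
    1 ≤ volume A := by
  by_contra! hlt
  obtain ⟨m, hm1, hm2⟩ := exists_between hlt
  have hmtop : m ≠ ∞ := ne_top_of_lt hm2
  have hlim : Tendsto (fun a : ℝ => ENNReal.ofReal (a ^ d) * m) (𝓝[>] 1) (𝓝 m) := by
    have h1 : Tendsto (fun a : ℝ => a ^ d) (𝓝 1) (𝓝 1) := by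
      simpa using (continuous_pow d).tendsto (1 : ℝ)
    simpa using ENNReal.Tendsto.mul_const
      (ENNReal.tendsto_ofReal (h1.mono_left nhdsWithin_le_nhds)) (Or.inr hmtop)
  obtain ⟨a, ham, ha⟩ := ((hlim.eventually (gt_mem_nhds hm2)).and self_mem_nhdsWithin).exists
  obtain ⟨t, ρ, htc, -, hρ, htA, hsum⟩ := Besicovitch.exists_closedBall_covering_tsum_measure_le
    volume (tsub_pos_of_lt hm1).ne' (fun _ => Ioi 0) A
    fun _ _ δ hδ => ⟨δ / 2, half_pos hδ, half_pos hδ, half_lt_self hδ⟩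
  rw [add_tsub_cancel_of_le hm1.le] at hsum
  have := htc.to_subtype
  have hρ0 : ∀ p : t, 0 < ρ p := fun p => hρ p p.2
  have hs0 : ∀ p : t, 0 < a * ρ p := fun p => mul_pos (by linarith) (hρ0 p)
  have hlt1 : ∑' p : t, volume (ball (p : Fin d → ℝ) (a * ρ p)) < 1 := by
    calc ∑' p : t, volume (ball (p : Fin d → ℝ) (a * ρ p))
        = ∑' p : t, ENNReal.ofReal (a ^ d) * volume (closedBall (p : Fin d → ℝ) (ρ p)) := by
          refine tsum_congr fun p => ?_
          rw [volume_ball_fin _ (hs0 p), volume_closedBall_fin _ (hρ0 p),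
            ← ENNReal.ofReal_mul (by positivity), ← mul_pow, mul_left_comm]
      _ ≤ ENNReal.ofReal (a ^ d) * m := by rw [ENNReal.tsum_mul_left]; gcongr
      _ < 1 := ham
  have hfin : ∑' p : t, ENNReal.ofReal (f (2 * (a * ρ p))) ≠ ∞ := by
    refine ne_top_of_le_ne_top (ENNReal.mul_ne_top ENNReal.ofReal_ne_top (ne_top_of_lt hlt1)) ?_
      (b := ENNReal.ofReal L * ∑' p : t, volume (ball (p : Fin d → ℝ) (a * ρ p)))
    rw [← ENNReal.tsum_mul_left]
    refine ENNReal.tsum_le_tsum fun p => ?_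
    have := hs0 p
    rw [volume_ball_fin _ this, ← ENNReal.ofReal_mul' (by positivity)]
    exact ENNReal.ofReal_le_ofReal (hL _ (by positivity))
  have hnull := hA t (fun p => p) (fun p => a * ρ p) hs0 hfin fun p hp => by
    obtain ⟨q, hq, hpq⟩ := mem_iUnion₂.1 (htA hp)
    refine mem_iUnion.2 ⟨⟨q, hq⟩, closedBall_subset_ball ?_ hpq⟩
    have := hρ0 ⟨q, hq⟩
    simp only at this ⊢
    nlinarith
  exact absurd (measure_le_tsum_of_diff_iUnion_eq_zero hnull) (not_le.2 (hI.symm ▸ hlt1))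

/-- If `f r ≤ L * r ^ d` then the Hausdorff `f`-measure is absolutely continuous. -/
lemma hausdorffFMeasure_absolutelyContinuous (hf0 : f 0 = 0) {L : ℝ}
    (hL : ∀ t, 0 < t → f t ≤ L * t ^ d) : hausdorffFMeasure d f ≪ volume := by
  have hvol : (Measure.mkMetric fun r => r ^ (d : ℝ) : Measure (Fin d → ℝ)) = volume := by
    simpa [Measure.hausdorffMeasure] using hausdorffMeasure_pi_real (ι := Fin d)
  have hle : hausdorffFMeasure d f ≤ ENNReal.ofReal (max L 1) • volume := by
    rw [← hvol]
    refine Measure.mkMetric_mono_smul ENNReal.ofReal_ne_top (by simp) ?_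
    filter_upwards [Ico_mem_nhdsGE (zero_lt_one (α := ENNReal))] with r hr
    have hrtop : r ≠ ∞ := ne_top_of_lt hr.2
    rcases eq_or_ne r 0 with rfl | hr0
    · simp [hf0]
    · have hpos := ENNReal.toReal_pos hr0 hrtop
      simp only [Pi.smul_apply, smul_eq_mul, ENNReal.rpow_natCast]
      nth_rw 2 [← ENNReal.ofReal_toReal hrtop]
      rw [← ENNReal.ofReal_pow hpos.le, ← ENNReal.ofReal_mul (by positivity)]
      refine ENNReal.ofReal_le_ofReal ((hL _ hpos).trans ?_)
      gcongr
      exact le_max_left _ _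
  exact (Measure.absolutelyContinuous_of_le hle).trans Measure.smul_absolutelyContinuous

end MassTransference

/-- Mass transference principle from balls to open sets (Koivusalo–Rams, Zhong): if the balls
`B_k ⊆ [0,1]^d` have radii tending to `0`, `limsup B_k` has full Lebesgue measure, and open sets
`E_k ⊆ B_k` satisfy `H^f_∞(E_k) > c·L^d(B_k)`, then `H^f(limsup E_k) = H^f([0,1]^d)`. -/
theorem mass_transference_balls_to_open (d : ℕ) (hd : 0 < d)
    (f : ℝ → ℝ)
    (hf_cont : ContinuousOn f (Set.Ici 0))
    (hf_mono : MonotoneOn f (Set.Ici 0))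
    (hf0 : f 0 = 0) (hf_pos : ∀ x, 0 < x → 0 < f x)
    (hf_prec : ∀ x y : ℝ, 0 < x → x < y → f y / y ^ d ≤ f x / x ^ d)
    (x : ℕ → (Fin d → ℝ)) (r : ℕ → ℝ) (hr_pos : ∀ k, 0 < r k)
    (hr_lim : Filter.Tendsto r Filter.atTop (nhds 0))
    (hB_sub : ∀ k, Metric.closedBall (x k) (r k) ⊆ Set.univ.pi fun _ => Set.Icc (0 : ℝ) 1)
    (hB_full : volume (Filter.limsup (fun k => Metric.closedBall (x k) (r k)) Filter.atTop) = 1)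
    (E : ℕ → Set (Fin d → ℝ)) (hE_open : ∀ k, IsOpen (E k))
    (hE_sub : ∀ k, E k ⊆ Metric.closedBall (x k) (r k))
    (c : ℝ) (hc : 0 < c)
    (hcont : ∀ k, ENNReal.ofReal c * volume (Metric.closedBall (x k) (r k)) <
      hausdorffContent f (E k)) :
    hausdorffFMeasure d f (Filter.limsup E Filter.atTop) =
      hausdorffFMeasure d f (Set.univ.pi fun _ => Set.Icc (0 : ℝ) 1) := by
  have hf : IsDimensionFunction d f := ⟨hf_cont, hf_mono, hf0, hf_pos, hf_prec⟩
  set I : Set (Fin d → ℝ) := Set.univ.pi fun _ => Set.Icc (0 : ℝ) 1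
  have hI : volume I = 1 := by
    rw [volume_pi_pi]
    simp
  have hlimB_sub : Filter.limsup (fun k => Metric.closedBall (x k) (r k)) Filter.atTop ⊆ I := by
    intro p hp
    obtain ⟨k, hk⟩ := (Filter.mem_limsup_iff_frequently_mem.1 hp).exists
    exact hB_sub k hk
  have hlimE_sub : Filter.limsup E Filter.atTop ⊆ I := by
    intro p hp
    obtain ⟨k, hk⟩ := (Filter.mem_limsup_iff_frequently_mem.1 hp).exists
    exact hB_sub k (hE_sub k hk)
  have hnull_of : ∀ {A : Set (Fin d → ℝ)}, MeasurableSet A → A ⊆ I → 1 ≤ volume A →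
      volume (I \ A) = 0 := fun hA hAI h1 => by
    rw [measure_sdiff hAI hA.nullMeasurableSet
      (ne_top_of_le_ne_top (by simp [hI]) (measure_mono hAI)), hI, tsub_eq_zero_of_le h1]
  have hlimB :
      volume (I \ Filter.limsup (fun k => Metric.closedBall (x k) (r k)) Filter.atTop) = 0 :=
    hnull_of (.measurableSet_limsup fun k => measurableSet_closedBall) hlimB_sub hB_full.ge
  have hcover : ∀ (ι : Type) [Countable ι] (y : ι → Fin d → ℝ) (s : ι → ℝ), (∀ i, 0 < s i) →
      ∑' i, ENNReal.ofReal (f (2 * s i)) ≠ ⊤ →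
      Filter.limsup E Filter.atTop ⊆ ⋃ i, Metric.ball (y i) (s i) →
      volume (I \ ⋃ i, Metric.ball (y i) (s i)) = 0 := fun ι _ y s hs hsum hcov =>
    ae_cover_of_limsup_subset hf hr_pos hr_lim hB_sub hlimB hE_open hE_sub hc hcont
      hs hsum hcov
  refine le_antisymm (measure_mono hlimE_sub) ?_
  by_cases hbdd : ∃ L : ℝ, ∀ t, 0 < t → f t ≤ L * t ^ d
  · obtain ⟨L, hL⟩ := hbdd
    have hzero : volume (I \ Filter.limsup E Filter.atTop) = 0 :=
      hnull_of (.measurableSet_limsup fun k => (hE_open k).measurableSet) hlimE_sub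
        (one_le_volume_of_le_mul_pow hI hcover hL)
    exact measure_mono_ae
      (ae_le_set.2 (hausdorffFMeasure_absolutelyContinuous hf0 hL hzero))
  · push Not at hbdd
    rw [hausdorffFMeasure_eq_top hf hI (hcover ℕ) hbdd]
    exact le_top
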